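/- Odd central moments of the number of order-2 branches (Lemma 3, odd case): for every fixed s ≥ 0, the expectation ⟨(S_{2,n} − n/4)^{2s+1}⟩ under P_n is asymptotically equivalent, as n → ∞, to ((2s+1)!!/(2·4^{2s+1}))·n^s. -/

import Mathlib

open MeasureTheory ProbabilityTheory Filter
open scoped NNReal Topology

/-- Binary trees: every internal node has exactly two children. -/
inductive BinTree : Type
  | leaf : BinTree
  | node : BinTree → BinTree → BinTree
  deriving DecidableEq

namespace BinTree

/-- The magnitude of a binary tree is its number of leaves. -/
def magnitude : BinTree → ℕ
  | leaf => 1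
  | node l r => magnitude l + magnitude r

/-- The Horton–Strahler order of (the root of) a binary tree:
leaves have order 1; a node whose two children have distinct orders has the max of the two;
a node whose two children have equal order `r` has order `r + 1`. -/
def ord : BinTree → ℕ
  | leaf => 1
  | node l r => if ord l = ord r then ord l + 1 else max (ord l) (ord r)

/-- `branches k τ` is `S_{k,n}(τ)`, the number of Horton–Strahler branches of order `k`
in `τ`, i.e. the number of maximal connected paths of nodes of order `k`.  It counts the
nodes of order `k` that head a branch: a new branch head of order `ord l + 1` is created
exactly at a node whose two children have equal order `ord l`, and every leaf heads an
order-1 branch. -/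
def branches (k : ℕ) : BinTree → ℕ
  | leaf => if k = 1 then 1 else 0
  | node l r => branches k l + branches k r +
      (if ord l = ord r ∧ ord l + 1 = k then 1 else 0)

end BinTree

/-- `treesOf n` is the finite set `Ω_n` of binary trees of magnitude `n`. -/
def treesOf : ℕ → Finset BinTree
  | 0 => ∅
  | 1 => {BinTree.leaf}
  | (n+2) => (Finset.range (n+1)).attach.biUnion fun k =>
      ((treesOf (k.1+1)) ×ˢ (treesOf (n+1-k.1))).image fun p => BinTree.node p.1 p.2
  decreasing_by
  · have := Finset.mem_range.mp k.2; omega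
  · omega

/-- Expectation `⟨f⟩` under the uniform probability measure `P_n` on `Ω_n` (the random model). -/
noncomputable def expect (n : ℕ) (f : BinTree → ℝ) : ℝ :=
  (∑ τ ∈ treesOf n, f τ) / (treesOf n).card

/-! ### Enumeration of trees -/

lemma BinTree.magnitude_pos (t : BinTree) : 0 < t.magnitude := by
  induction t with
  | leaf => simp [BinTree.magnitude]
  | node l r ihl ihr => simp only [BinTree.magnitude]; omega

lemma BinTree.one_le_ord (t : BinTree) : 1 ≤ t.ord := by
  induction t with
  | leaf => simp [BinTree.ord]
  | node l r ihl ihr => simp only [BinTree.ord]; split_ifs <;> grind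

lemma BinTree.ord_eq_one_iff (t : BinTree) : t.ord = 1 ↔ t = .leaf := by
  cases t with
  | leaf => simp [BinTree.ord]
  | node l r =>
    have := l.one_le_ord
    have := r.one_le_ord
    simp only [BinTree.ord, reduceCtorEq, iff_false]
    split_ifs <;> grind

lemma BinTree.branches_two_node (l r : BinTree) :
    BinTree.branches 2 (.node l r) = BinTree.branches 2 l + BinTree.branches 2 r +
      if l = .leaf ∧ r = .leaf then 1 else 0 := by
  have h : (l.ord = r.ord ∧ l.ord + 1 = 2) ↔ (l = .leaf ∧ r = .leaf) := by
    rw [← l.ord_eq_one_iff, ← r.ord_eq_one_iff]; omega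
  simp only [BinTree.branches, h]

lemma magnitude_of_mem_treesOf (n : ℕ) : ∀ t ∈ treesOf n, t.magnitude = n := by
  induction n using Nat.strong_induction_on with
  | _ n ih =>
    intro t ht
    match n, ih, ht with
    | 0, _, ht => simp [treesOf] at ht
    | 1, _, ht => simp only [treesOf, Finset.mem_singleton] at ht; subst ht; rfl
    | n + 2, ih, ht =>
      simp only [treesOf, Finset.mem_biUnion, Finset.mem_attach, true_and, Finset.mem_image,
        Finset.mem_product, Subtype.exists, Finset.mem_range] at ht
      obtain ⟨k, hk, ⟨l, r⟩, ⟨hl, hr⟩, rfl⟩ := ht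
      have h1 := ih (k + 1) (by omega) l hl
      have h2 := ih (n + 1 - k) (by omega) r hr
      simp only [BinTree.magnitude, h1, h2]
      omega

lemma sum_treesOf_add_two {M : Type*} [AddCommMonoid M] (n : ℕ) (f : BinTree → M) :
    ∑ t ∈ treesOf (n + 2), f t = ∑ k ∈ Finset.range (n + 1),
      ∑ l ∈ treesOf (k + 1), ∑ r ∈ treesOf (n + 1 - k), f (.node l r) := by
  have hinj : Function.Injective fun p : BinTree × BinTree => BinTree.node p.1 p.2 := by
    rintro ⟨a, b⟩ ⟨c, d⟩ h
    simpa using h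
  rw [treesOf, Finset.sum_biUnion]
  · rw [← Finset.sum_attach (Finset.range (n + 1))]
    refine Finset.sum_congr rfl fun k _ => ?_
    rw [Finset.sum_image hinj.injOn, Finset.sum_product]
  · intro a _ b _ hab
    simp only [Function.onFun, Finset.disjoint_left, Finset.mem_image, Finset.mem_product]
    rintro _ ⟨p, ⟨hp, _⟩, rfl⟩ ⟨q, ⟨hq, _⟩, h⟩
    have h' : q = p := hinj h
    subst h'
    have h1 := magnitude_of_mem_treesOf _ _ hp
    have h2 := magnitude_of_mem_treesOf _ _ hq
    exact hab (Subtype.ext (by omega))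

lemma treesOf_nonempty (n : ℕ) : (treesOf (n + 1)).Nonempty := by
  induction n with
  | zero => simp [treesOf]
  | succ n ih =>
    obtain ⟨t, ht⟩ := ih
    refine ⟨.node .leaf t, ?_⟩
    simp only [treesOf, Finset.mem_biUnion, Finset.mem_attach, true_and, Finset.mem_image,
      Finset.mem_product, Subtype.exists, Finset.mem_range]
    exact ⟨0, by omega, (.leaf, t), ⟨by simp [treesOf], by simpa using ht⟩, rfl⟩

lemma leaf_mem_treesOf_iff (n : ℕ) : BinTree.leaf ∈ treesOf n ↔ n = 1 := by
  refine ⟨fun h => (magnitude_of_mem_treesOf n _ h).symm, ?_⟩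
  rintro rfl
  simp [treesOf]

/-! ### The bivariate generating function -/

section GeneratingFunction

open Polynomial

/-- The generating polynomial of the number of order-2 branches over `Ω_n`. -/
noncomputable def branchPoly (n : ℕ) : ℝ[X] := ∑ t ∈ treesOf n, X ^ BinTree.branches 2 t

lemma branchPoly_zero : branchPoly 0 = 0 := by simp [branchPoly, treesOf]

lemma branchPoly_one : branchPoly 1 = 1 := by simp [branchPoly, treesOf, BinTree.branches]

lemma branchPoly_add_two (n : ℕ) :
    branchPoly (n + 2) =
      ∑ p ∈ Finset.HasAntidiagonal.antidiagonal (n + 2), branchPoly p.1 * branchPoly p.2 +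
      if n = 0 then X - 1 else 0 := by
  have key : ∀ a b : ℕ, ∑ l ∈ treesOf a, ∑ r ∈ treesOf b,
      (X : ℝ[X]) ^ BinTree.branches 2 (.node l r) =
        branchPoly a * branchPoly b + if a = 1 ∧ b = 1 then X - 1 else 0 := by
    intro a b
    by_cases h : a = 1 ∧ b = 1
    · obtain ⟨rfl, rfl⟩ := h
      simp only [treesOf, branchPoly, Finset.sum_singleton, BinTree.branches_two_node]
      simp [BinTree.branches]
    · rw [if_neg h, add_zero, branchPoly, branchPoly, Finset.sum_mul_sum]
      refine Finset.sum_congr rfl fun l hl => Finset.sum_congr rfl fun r hr => ?_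
      have : ¬ (l = .leaf ∧ r = .leaf) := by
        rintro ⟨rfl, rfl⟩
        exact h ⟨(leaf_mem_treesOf_iff a).1 hl, (leaf_mem_treesOf_iff b).1 hr⟩
      rw [BinTree.branches_two_node, if_neg this, add_zero, pow_add]
  rw [Finset.Nat.sum_antidiagonal_eq_sum_range_succ_mk, Finset.sum_range_succ,
    Finset.sum_range_succ', branchPoly, sum_treesOf_add_two]
  simp only [key, Finset.sum_add_distrib, branchPoly_zero, Nat.sub_self, mul_zero, zero_mul,
    add_zero]
  congr 1
  · refine Finset.sum_congr rfl fun k hk => ?_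
    rw [show n + 2 - (k + 1) = n + 1 - k by omega]
  · rw [Finset.sum_eq_single_of_mem 0 (by simp)]
    · simp
    · intro k _ hk
      simp [hk]

/-- The bivariate generating function of trees by magnitude and number of order-2 branches. -/
noncomputable def branchSeries : PowerSeries ℝ[X] := PowerSeries.mk branchPoly

lemma branchSeries_eq : branchSeries = PowerSeries.X - PowerSeries.X ^ 2 +
    PowerSeries.C X * PowerSeries.X ^ 2 + branchSeries ^ 2 := by
  ext1 n
  match n with
  | 0 => simp [branchSeries, branchPoly_zero, sq]
  | 1 =>
    rw [sq branchSeries]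
    simp [branchSeries, branchPoly_zero, branchPoly_one, PowerSeries.coeff_mul,
      Finset.Nat.antidiagonal_succ, PowerSeries.coeff_X_pow]
  | n + 2 =>
    rw [sq branchSeries]
    simp only [map_add, map_sub, PowerSeries.coeff_X, PowerSeries.coeff_X_pow,
      PowerSeries.coeff_C_mul]
    simp only [PowerSeries.coeff_mul, branchSeries, PowerSeries.coeff_mk]
    rw [branchPoly_add_two]
    by_cases h : n = 0
    · simp [h]; ring
    · simp [h]

/-- The coefficientwise derivative of a power series over a polynomial ring. -/
noncomputable def coeffDeriv (F : PowerSeries ℝ[X]) : PowerSeries ℝ[X] :=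
  PowerSeries.mk fun n => derivative (PowerSeries.coeff n F)

/-- The derivation `z ∂/∂z - 2 y ∂/∂y` on power series in `z` over polynomials in `y`. -/
noncomputable def eulerDeriv (F : PowerSeries ℝ[X]) : PowerSeries ℝ[X] :=
  PowerSeries.mk fun n => (n : ℝ[X]) * PowerSeries.coeff n F -
    2 * X * derivative (PowerSeries.coeff n F)

lemma coeffDeriv_add (F G : PowerSeries ℝ[X]) :
    coeffDeriv (F + G) = coeffDeriv F + coeffDeriv G := by
  ext1 n; simp [coeffDeriv]

lemma coeffDeriv_sub (F G : PowerSeries ℝ[X]) :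
    coeffDeriv (F - G) = coeffDeriv F - coeffDeriv G := by
  ext1 n; simp [coeffDeriv]

lemma coeffDeriv_mul (F G : PowerSeries ℝ[X]) :
    coeffDeriv (F * G) = coeffDeriv F * G + F * coeffDeriv G := by
  ext1 n
  simp only [coeffDeriv, PowerSeries.coeff_mk, PowerSeries.coeff_mul, map_add, derivative_sum,
    derivative_mul, ← Finset.sum_add_distrib]

lemma eulerDeriv_add (F G : PowerSeries ℝ[X]) :
    eulerDeriv (F + G) = eulerDeriv F + eulerDeriv G := by
  ext1 n; simp [eulerDeriv]; ring

lemma eulerDeriv_sub (F G : PowerSeries ℝ[X]) :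
    eulerDeriv (F - G) = eulerDeriv F - eulerDeriv G := by
  ext1 n; simp [eulerDeriv]; ring

lemma eulerDeriv_mul (F G : PowerSeries ℝ[X]) :
    eulerDeriv (F * G) = eulerDeriv F * G + F * eulerDeriv G := by
  ext1 n
  simp only [eulerDeriv, PowerSeries.coeff_mk, PowerSeries.coeff_mul, map_add, derivative_sum,
    derivative_mul, ← Finset.sum_add_distrib, Finset.mul_sum, ← Finset.sum_sub_distrib]
  refine Finset.sum_congr rfl fun p hp => ?_
  rw [← Finset.HasAntidiagonal.mem_antidiagonal.1 hp]
  push_cast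
  ring

lemma coeffDeriv_X : coeffDeriv PowerSeries.X = 0 := by
  ext1 n; simp only [coeffDeriv, PowerSeries.coeff_mk, PowerSeries.coeff_X]; split_ifs <;> simp

lemma coeffDeriv_C (p : ℝ[X]) : coeffDeriv (PowerSeries.C p) = PowerSeries.C (derivative p) := by
  ext1 n; simp only [coeffDeriv, PowerSeries.coeff_mk, PowerSeries.coeff_C]; split_ifs <;> simp

lemma eulerDeriv_X : eulerDeriv PowerSeries.X = PowerSeries.X := by
  ext1 n
  simp only [eulerDeriv, PowerSeries.coeff_mk, PowerSeries.coeff_X]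
  split_ifs with h <;> simp [h]

lemma eulerDeriv_C (p : ℝ[X]) :
    eulerDeriv (PowerSeries.C p) = - (2 * PowerSeries.C X * PowerSeries.C (derivative p)) := by
  ext1 n
  rw [show (2 : PowerSeries ℝ[X]) = PowerSeries.C 2 from (map_ofNat PowerSeries.C 2).symm,
    ← map_mul, ← map_mul]
  simp only [eulerDeriv, PowerSeries.coeff_mk, map_neg, PowerSeries.coeff_C]
  split_ifs with h <;> simp [h]

lemma eulerDeriv_branchSeries : eulerDeriv (eulerDeriv branchSeries) - eulerDeriv branchSeries =
    4 * PowerSeries.C X * coeffDeriv (coeffDeriv branchSeries) := by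
  set F := branchSeries with hF
  set z : PowerSeries ℝ[X] := PowerSeries.X with hz
  set y : PowerSeries ℝ[X] := PowerSeries.C X with hy
  have h0 : F = z - z * z + y * (z * z) + F * F := by
    simpa only [sq] using branchSeries_eq
  have hEy : eulerDeriv y = - (2 * y) := by rw [hy, eulerDeriv_C]; simp
  have hDy : coeffDeriv y = 1 := by rw [hy, coeffDeriv_C]; simp
  have hEz : eulerDeriv z = z := eulerDeriv_X
  have hDz : coeffDeriv z = 0 := coeffDeriv_X
  have e1 := congrArg eulerDeriv h0
  simp only [eulerDeriv_add, eulerDeriv_sub, eulerDeriv_mul, hEy, hEz] at e1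
  replace e1 : eulerDeriv F = z - (z * z + z * z) + (eulerDeriv F * F + F * eulerDeriv F) := by
    linear_combination e1
  have e2 := congrArg eulerDeriv e1
  simp only [eulerDeriv_add, eulerDeriv_sub, eulerDeriv_mul, hEz] at e2
  have d1 := congrArg coeffDeriv h0
  simp only [coeffDeriv_add, coeffDeriv_sub, coeffDeriv_mul, hDy, hDz] at d1
  replace d1 : coeffDeriv F = z * z + (coeffDeriv F * F + F * coeffDeriv F) := by
    linear_combination d1
  have d2 := congrArg coeffDeriv d1
  simp only [coeffDeriv_add, coeffDeriv_mul, hDz] at d2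
  set a := eulerDeriv F
  set b := eulerDeriv a
  set c := coeffDeriv F
  set d := coeffDeriv c
  have hu : (1 - 2 * F) ^ 3 ≠ 0 := by
    refine pow_ne_zero _ fun h => ?_
    have := congrArg (PowerSeries.coeff 0) h
    rw [show (2 : PowerSeries ℝ[X]) = PowerSeries.C 2 from (map_ofNat PowerSeries.C 2).symm] at this
    simp [hF, branchSeries, branchPoly_zero] at this
  have h1 : (1 - 2 * F) * a = z - 2 * z ^ 2 := by linear_combination e1
  have h2 : (1 - 2 * F) * b - 2 * a ^ 2 = z - 4 * z ^ 2 := by linear_combination e2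
  have k1 : (1 - 2 * F) * c = z ^ 2 := by linear_combination d1
  have k2 : (1 - 2 * F) * d - 2 * c ^ 2 = 0 := by linear_combination d2
  refine sub_eq_zero.1 ((mul_eq_zero.1 ?_).resolve_left hu)
  linear_combination (1 - 2 * F) ^ 2 * h2 - (1 - 2 * F) ^ 2 * h1 - 4 * y * (1 - 2 * F) ^ 2 * k2 +
    2 * ((1 - 2 * F) * a + z - 2 * z ^ 2) * h1 - 8 * y * ((1 - 2 * F) * c + z ^ 2) * k1 +
    8 * z ^ 2 * h0

lemma X_mul_derivative_branchPoly (n : ℕ) : X * derivative (branchPoly n) =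
    ∑ t ∈ treesOf n, C (BinTree.branches 2 t : ℝ) * X ^ BinTree.branches 2 t := by
  rw [branchPoly, derivative_sum, Finset.mul_sum]
  refine Finset.sum_congr rfl fun t _ => ?_
  rcases BinTree.branches 2 t with _ | k
  · simp
  · rw [derivative_X_pow]; simp; ring

lemma X_sq_mul_derivative_derivative_branchPoly (n : ℕ) :
    X ^ 2 * derivative (derivative (branchPoly n)) =
      ∑ t ∈ treesOf n, C ((BinTree.branches 2 t : ℝ) * (BinTree.branches 2 t - 1)) *
        X ^ BinTree.branches 2 t := by
  simp only [branchPoly, derivative_sum, Finset.mul_sum]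
  refine Finset.sum_congr rfl fun t _ => ?_
  rcases BinTree.branches 2 t with _ | _ | k
  · simp
  · simp
  · simp; ring

lemma branchPoly_ode (n : ℕ) :
    ∑ t ∈ treesOf n, C (((n : ℝ) - 2 * BinTree.branches 2 t) *
        ((n : ℝ) - 2 * BinTree.branches 2 t - 1)) * X ^ (BinTree.branches 2 t + 1) =
      ∑ t ∈ treesOf n, C (4 * (BinTree.branches 2 t : ℝ) * (BinTree.branches 2 t - 1)) *
        X ^ BinTree.branches 2 t := by
  have h := congrArg (PowerSeries.coeff n) eulerDeriv_branchSeries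
  rw [show (4 : PowerSeries ℝ[X]) = PowerSeries.C 4 from (map_ofNat PowerSeries.C 4).symm,
    mul_assoc] at h
  simp only [map_sub, eulerDeriv, coeffDeriv, PowerSeries.coeff_mk, PowerSeries.coeff_C_mul,
    branchSeries, derivative_mul, derivative_natCast, derivative_X, derivative_ofNat] at h
  have h0 : ∑ t ∈ treesOf n, C (((n : ℝ) - 2 * BinTree.branches 2 t) *
        ((n : ℝ) - 2 * BinTree.branches 2 t - 1)) * X ^ (BinTree.branches 2 t + 1) =
      X * ((n : ℝ[X]) * ((n : ℝ[X]) - 1) * branchPoly n +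
        (6 - 4 * (n : ℝ[X])) * (X * derivative (branchPoly n)) +
        4 * (X ^ 2 * derivative (derivative (branchPoly n)))) := by
    rw [X_mul_derivative_branchPoly, X_sq_mul_derivative_derivative_branchPoly, branchPoly]
    simp only [Finset.mul_sum, ← Finset.sum_add_distrib]
    refine Finset.sum_congr rfl fun t _ => ?_
    simp only [map_mul, map_sub, map_natCast, map_one, map_ofNat]
    ring
  have h1 : ∑ t ∈ treesOf n, C (4 * (BinTree.branches 2 t : ℝ) * (BinTree.branches 2 t - 1)) *
        X ^ BinTree.branches 2 t = 4 * (X ^ 2 * derivative (derivative (branchPoly n))) := by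
    rw [X_sq_mul_derivative_derivative_branchPoly, Finset.mul_sum]
    refine Finset.sum_congr rfl fun t _ => ?_
    simp only [map_mul, map_sub, map_natCast, map_one, map_ofNat]
    ring
  rw [h0, h1]
  linear_combination X * h

/-- The Stein-type identity characterising the law of the number of order-2 branches. -/
lemma sum_branches_stein (n : ℕ) (f : ℕ → ℝ) :
    ∑ t ∈ treesOf n, ((n : ℝ) - 2 * BinTree.branches 2 t) *
        ((n : ℝ) - 2 * BinTree.branches 2 t - 1) * f (BinTree.branches 2 t + 1) =
      ∑ t ∈ treesOf n, 4 * (BinTree.branches 2 t : ℝ) * (BinTree.branches 2 t - 1) *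
        f (BinTree.branches 2 t) := by
  have h := congrArg ((Polynomial.basisMonomials ℝ).constr ℝ f) (branchPoly_ode n)
  have key : ∀ (c : ℝ) (k : ℕ),
      (Polynomial.basisMonomials ℝ).constr ℝ f (C c * X ^ k) = c * f k := by
    intro c k
    have := (Polynomial.basisMonomials ℝ).constr_basis ℝ f k
    rw [Polynomial.coe_basisMonomials] at this
    rw [← smul_eq_C_mul, map_smul, smul_eq_mul, X_pow_eq_monomial, this]
  simpa only [map_sum, key] using h

end GeneratingFunction

/-! ### Moments -/

/-- The `j`-th moment of `4 S_{2,n} - n`. -/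
noncomputable def scaledMoment (j n : ℕ) : ℝ :=
  expect n fun t => (4 * (BinTree.branches 2 t : ℝ) - n) ^ j

lemma expect_stein (n : ℕ) (g : ℝ → ℝ) :
    expect n (fun t => ((n : ℝ) - (4 * (BinTree.branches 2 t : ℝ) - n)) *
        ((n : ℝ) - (4 * (BinTree.branches 2 t : ℝ) - n) - 2) *
          g (4 * (BinTree.branches 2 t : ℝ) - n + 4)) =
      expect n (fun t => ((n : ℝ) + (4 * (BinTree.branches 2 t : ℝ) - n)) *
        ((n : ℝ) + (4 * (BinTree.branches 2 t : ℝ) - n) - 4) *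
          g (4 * (BinTree.branches 2 t : ℝ) - n)) := by
  have h := sum_branches_stein n fun k => 4 * g (4 * (k : ℝ) - n)
  unfold expect
  congr 1
  convert h using 1
  · refine Finset.sum_congr rfl fun t _ => ?_
    push_cast
    rw [show 4 * (BinTree.branches 2 t : ℝ) - n + 4 = 4 * (BinTree.branches 2 t + 1) - n by ring]
    ring
  · exact Finset.sum_congr rfl fun t _ => by ring

lemma exists_add_four_pow (j : ℕ) : ∃ r : ℕ → ℝ, ∀ x : ℝ, (x + 4) ^ j = x ^ j +
    4 * j * x ^ (j - 1) + 8 * j * (j - 1) * x ^ (j - 2) +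
      ∑ i ∈ Finset.range (j - 2), r i * x ^ i := by
  rcases j with _ | _ | j
  · exact ⟨0, by simp⟩
  · exact ⟨0, by simp⟩
  · refine ⟨fun i => 4 ^ (j + 2 - i) * (j + 2).choose i, fun x => ?_⟩
    have h : (j + 2).choose j = (j + 2).choose 2 := by
      rw [← Nat.choose_symm_add, add_comm]
    have h2 : (((j + 2).choose 2 : ℕ) : ℝ) = (j + 2) * (j + 1) / 2 := by
      rw [Nat.cast_choose_two]; push_cast; ring
    rw [add_pow, Finset.sum_range_succ, Finset.sum_range_succ, Finset.sum_range_succ]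
    simp only [Nat.add_sub_cancel, Nat.choose_self, Nat.sub_self, Nat.choose_succ_self_right, h, h2,
      show j + 2 - j = 2 by omega, show j + 2 - (j + 1) = 1 by omega,
      show j + 1 + 1 = j + 2 by rfl, show j + 2 - 1 = j + 1 by omega]
    rw [Finset.sum_congr rfl fun i _ => mul_assoc (x ^ i) _ _]
    simp only [mul_comm (x ^ _) (_ * _)]
    push_cast
    ring

/-- The recursion for the moments of `4 S_{2,n} - n`. -/
lemma exists_scaledMoment_rec (j : ℕ) : ∃ r : ℕ → ℝ, ∀ n : ℕ,
    (4 * (n : ℝ) - (6 + 4 * j)) * scaledMoment (j + 1) n =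
      (n : ℝ) ^ 2 * (4 * j * scaledMoment (j - 1) n + 8 * j * (j - 1) * scaledMoment (j - 2) n +
        ∑ i ∈ Finset.range (j - 2), r i * scaledMoment i n) +
      n * ((2 - 8 * j) * scaledMoment j n - (8 * j + 16 * j * (j - 1)) * scaledMoment (j - 1) n -
        16 * j * (j - 1) * scaledMoment (j - 2) n -
        ∑ i ∈ Finset.range (j - 2), r i * (2 * scaledMoment (i + 1) n + 2 * scaledMoment i n)) +
      ((8 * j * (j - 1) + 8 * j) * scaledMoment j n + 16 * j * (j - 1) * scaledMoment (j - 1) n +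
        ∑ i ∈ Finset.range (j - 2),
          r i * (scaledMoment (i + 2) n + 2 * scaledMoment (i + 1) n)) := by
  obtain ⟨r, hr⟩ := exists_add_four_pow j
  refine ⟨r, fun n => ?_⟩
  let E : (BinTree → ℝ) →ₗ[ℝ] ℝ :=
    { toFun := expect n
      map_add' := fun f g => by simp [expect, Finset.sum_add_distrib, add_div]
      map_smul' := fun c f => by simp [expect, ← Finset.mul_sum, mul_div_assoc] }
  let P : ℕ → BinTree → ℝ := fun i t => (4 * (BinTree.branches 2 t : ℝ) - n) ^ i
  have hE : ∀ i, scaledMoment i n = E (P i) := fun i => rfl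
  have h : E _ = E _ := expect_stein n (· ^ j)
  simp only [hE]
  rw [← sub_eq_zero, ← map_sub] at h
  have hE0 : E ((4 * (n : ℝ) - (6 + 4 * j)) • P (j + 1) -
      ((n : ℝ) ^ 2 • ((4 * j : ℝ) • P (j - 1) + (8 * j * (j - 1) : ℝ) • P (j - 2) +
        ∑ i ∈ Finset.range (j - 2), r i • P i) +
      (n : ℝ) • ((2 - 8 * j : ℝ) • P j - (8 * j + 16 * j * (j - 1) : ℝ) • P (j - 1) -
        (16 * j * (j - 1) : ℝ) • P (j - 2) -
        ∑ i ∈ Finset.range (j - 2), r i • ((2 : ℝ) • P (i + 1) + (2 : ℝ) • P i)) +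
      ((8 * j * (j - 1) + 8 * j : ℝ) • P j + (16 * j * (j - 1) : ℝ) • P (j - 1) +
        ∑ i ∈ Finset.range (j - 2), r i • (P (i + 2) + (2 : ℝ) • P (i + 1))))) = 0 := by
    rw [← neg_eq_zero, ← map_neg, ← h]
    congr 1
    funext t
    simp only [Pi.add_apply, Pi.sub_apply, Pi.neg_apply, Pi.smul_apply, smul_eq_mul,
      Finset.sum_apply, P, hr]
    generalize 4 * (BinTree.branches 2 t : ℝ) - n = x
    have hA : ∑ i ∈ Finset.range (j - 2), r i * (2 * x ^ (i + 1) + 2 * x ^ i) =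
        (2 * x + 2) * ∑ i ∈ Finset.range (j - 2), r i * x ^ i := by
      rw [Finset.mul_sum]; exact Finset.sum_congr rfl fun i _ => by ring
    have hB : ∑ i ∈ Finset.range (j - 2), r i * (x ^ (i + 2) + 2 * x ^ (i + 1)) =
        (x ^ 2 + 2 * x) * ∑ i ∈ Finset.range (j - 2), r i * x ^ i := by
      rw [Finset.mul_sum]; exact Finset.sum_congr rfl fun i _ => by ring
    rw [hA, hB]
    generalize ∑ i ∈ Finset.range (j - 2), r i * x ^ i = R
    rcases j with _ | _ | j
    · simp; ring
    · simp; ring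
    · simp only [show j + 2 - 1 = j + 1 by omega]
      push_cast
      ring
  simp only [map_add, map_sub, map_smul, map_sum, smul_eq_mul] at hE0
  exact sub_eq_zero.1 hE0

lemma scaledMoment_zero (n : ℕ) : scaledMoment 0 (n + 1) = 1 := by
  have : ((treesOf (n + 1)).card : ℝ) ≠ 0 := by
    exact_mod_cast (Finset.card_pos.2 (treesOf_nonempty n)).ne'
  simp [scaledMoment, expect, this]

lemma tendsto_pow_mul_div_pow {f : ℕ → ℝ} {k p q : ℕ} {l : ℝ}
    (hf : Tendsto (fun n : ℕ => f n / (n : ℝ) ^ k) atTop (𝓝 l)) (h : p + k = q) :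
    Tendsto (fun n : ℕ => (n : ℝ) ^ p * f n / (n : ℝ) ^ q) atTop (𝓝 l) := by
  refine hf.congr' ?_
  filter_upwards [eventually_gt_atTop 0] with n hn
  have : (n : ℝ) ≠ 0 := by positivity
  rw [← h, pow_add]
  field_simp

lemma tendsto_pow_mul_div_pow_zero {f : ℕ → ℝ} {k p q : ℕ} {l : ℝ}
    (hf : Tendsto (fun n : ℕ => f n / (n : ℝ) ^ k) atTop (𝓝 l)) (h : p + k < q) :
    Tendsto (fun n : ℕ => (n : ℝ) ^ p * f n / (n : ℝ) ^ q) atTop (𝓝 0) := by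
  obtain ⟨d, rfl⟩ := Nat.exists_eq_add_of_lt h
  have h1 : Tendsto (fun n : ℕ => ((n : ℝ) ^ (d + 1))⁻¹) atTop (𝓝 0) :=
    ((tendsto_pow_atTop (Nat.succ_ne_zero d)).comp tendsto_natCast_atTop_atTop).inv_tendsto_atTop
  have h2 := (tendsto_pow_mul_div_pow hf (rfl : p + k = p + k)).mul h1
  rw [mul_zero] at h2
  refine h2.congr fun n => ?_
  rw [add_assoc (p + k), pow_add _ (p + k) (d + 1), div_mul_eq_div_div,
    div_eq_mul_inv _ (_ ^ (d + 1))]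

lemma tendsto_scaledMoment_succ {j e : ℕ} {c : ℕ → ℝ} {L₁ L₂ L₃ : ℝ} (he : e = (j + 1) / 2)
    (hM : ∀ i ≤ j, Tendsto (fun n : ℕ => scaledMoment i n / (n : ℝ) ^ (i / 2)) atTop (𝓝 (c i)))
    (h₁ : Tendsto (fun n : ℕ => (4 * j : ℝ) * ((n : ℝ) ^ 2 * scaledMoment (j - 1) n /
      (n : ℝ) ^ (e + 1))) atTop (𝓝 L₁))
    (h₂ : Tendsto (fun n : ℕ => (8 * j * (j - 1) : ℝ) * ((n : ℝ) ^ 2 * scaledMoment (j - 2) n /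
      (n : ℝ) ^ (e + 1))) atTop (𝓝 L₂))
    (h₃ : Tendsto (fun n : ℕ => (n : ℝ) ^ 1 * scaledMoment j n / (n : ℝ) ^ (e + 1))
      atTop (𝓝 L₃)) :
    Tendsto (fun n : ℕ => scaledMoment (j + 1) n / (n : ℝ) ^ e) atTop
      (𝓝 ((L₁ + L₂ + (2 - 8 * j) * L₃) / 4)) := by
  obtain ⟨r, hr⟩ := exists_scaledMoment_rec j
  let u : ℕ → ℕ → ℕ → ℝ := fun p i n => (n : ℝ) ^ p * scaledMoment i n / (n : ℝ) ^ (e + 1)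
  have hu : ∀ p i, i ≤ j → p + i / 2 < e + 1 → Tendsto (u p i) atTop (𝓝 0) :=
    fun p i hi h => tendsto_pow_mul_div_pow_zero (hM i hi) h
  have hcu : ∀ (a : ℝ) (p i : ℕ), (a = 0 ∨ i ≤ j ∧ p + i / 2 < e + 1) →
      Tendsto (fun n => a * u p i n) atTop (𝓝 0) := by
    rintro a p i (rfl | ⟨hi, h⟩)
    · simp
    · simpa using (hu p i hi h).const_mul a
  have hsum : ∀ p d, p + d ≤ 2 → Tendsto (fun n => ∑ i ∈ Finset.range (j - 2), r i * u p (i + d) n)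
      atTop (𝓝 0) := by
    intro p d hpd
    rw [show (0 : ℝ) = ∑ i ∈ Finset.range (j - 2), 0 by simp]
    refine tendsto_finsetSum _ fun i hi => hcu _ _ _ (Or.inr ?_)
    rw [Finset.mem_range] at hi
    omega
  have hj : ((j : ℝ) = 0 ∨ 1 ≤ j) := by
    rcases j with _ | j
    · simp
    · right; omega
  have hj2 : ((j : ℝ) * (j - 1) = 0 ∨ 2 ≤ j) := by
    rcases j with _ | _ | j
    · simp
    · simp
    · right; omega
  have t1 := hcu (8 * j + 16 * j * (j - 1)) 1 (j - 1)
    (hj.imp (fun h => by simp [h]) fun h => by omega)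
  have t2 := hcu (16 * j * (j - 1)) 1 (j - 2)
    (hj2.imp (fun h => by linear_combination 16 * h) fun h => by omega)
  have t3 := hcu (8 * j * (j - 1) + 8 * j) 0 j (Or.inr (by omega))
  have t4 := hcu (16 * j * (j - 1)) 0 (j - 1)
    (hj2.imp (fun h => by linear_combination 16 * h) fun h => by omega)
  have key := ((((((((((h₁.add h₂).add (hsum 2 0 le_rfl)).add (h₃.const_mul (2 - 8 * (j : ℝ)))).sub
    t1).sub t2).sub ((hsum 1 1 le_rfl).const_mul 2)).sub ((hsum 1 0 (by omega)).const_mul 2)).add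
    t3).add t4).add (hsum 0 2 le_rfl)).add ((hsum 0 1 (by omega)).const_mul 2)
  have hden : Tendsto (fun n : ℕ => 4 - (6 + 4 * (j : ℝ)) / n) atTop (𝓝 4) := by
    simpa using (tendsto_const_nhds (x := (4 : ℝ))).sub
      (tendsto_const_div_atTop_nhds_zero_nat (6 + 4 * (j : ℝ)))
  have hfin := key.div hden (by norm_num)
  simp only [mul_zero, add_zero, sub_zero] at hfin
  refine hfin.congr' ?_
  filter_upwards [eventually_gt_atTop 0, hden.eventually_ne (by norm_num : (4 : ℝ) ≠ 0)] with n hn hd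
  have hn0 : (n : ℝ) ≠ 0 := by positivity
  have hs : ∀ p d, ∑ i ∈ Finset.range (j - 2), r i * u p (i + d) n =
      (n : ℝ) ^ p * (∑ i ∈ Finset.range (j - 2), r i * scaledMoment (i + d) n) /
        (n : ℝ) ^ (e + 1) := by
    intro p d
    rw [Finset.mul_sum, Finset.sum_div]
    exact Finset.sum_congr rfl fun i _ => by simp only [u]; ring
  have hrn := hr n
  simp only [mul_add, Finset.sum_add_distrib, mul_left_comm (r _) 2, ← Finset.mul_sum] at hrn
  rw [Pi.div_apply, div_eq_iff hd]
  have hs0 : ∀ p, ∑ i ∈ Finset.range (j - 2), r i * u p i n = (n : ℝ) ^ p *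
      (∑ i ∈ Finset.range (j - 2), r i * scaledMoment i n) / (n : ℝ) ^ (e + 1) := fun p => hs p 0
  simp only [hs, hs0]
  simp only [u]
  have hL : scaledMoment (j + 1) n / (n : ℝ) ^ e * (4 - (6 + 4 * (j : ℝ)) / n) =
      (4 * (n : ℝ) - (6 + 4 * j)) * scaledMoment (j + 1) n / (n : ℝ) ^ (e + 1) := by
    rw [pow_succ]; field_simp
  rw [hL, hrn]
  ring

/-- Limits of the normalised moments of `4 S_{2,n} - n`. -/
noncomputable def momentLimit (j : ℕ) : ℝ :=
  if Even j then (Nat.doubleFactorial (j - 1) : ℝ) else (Nat.doubleFactorial j : ℝ) / 2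

lemma momentLimit_even (s : ℕ) : momentLimit (2 * s) = Nat.doubleFactorial (2 * s - 1) := by
  simp [momentLimit]

lemma momentLimit_odd (s : ℕ) :
    momentLimit (2 * s + 1) = (Nat.doubleFactorial (2 * s + 1) : ℝ) / 2 := by
  simp [momentLimit]

lemma tendsto_scaledMoment (j : ℕ) :
    Tendsto (fun n : ℕ => scaledMoment j n / (n : ℝ) ^ (j / 2)) atTop (𝓝 (momentLimit j)) := by
  induction j using Nat.strong_induction_on with
  | _ j ih =>
  rcases j with _ | j
  · rw [show momentLimit 0 = 1 by simp [momentLimit]]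
    refine tendsto_const_nhds.congr' ?_
    filter_upwards [eventually_gt_atTop 0] with n hn
    obtain ⟨m, rfl⟩ := Nat.exists_eq_succ_of_ne_zero hn.ne'
    simp [scaledMoment_zero]
  have hM : ∀ i ≤ j, Tendsto (fun n : ℕ => scaledMoment i n / (n : ℝ) ^ (i / 2)) atTop
    (𝓝 (momentLimit i)) := fun i hi => ih i (by omega)
  obtain ⟨s, rfl | rfl⟩ := Nat.even_or_odd' j
  · rw [show (2 * s + 1) / 2 = s by omega]
    have h₃ := tendsto_pow_mul_div_pow (p := 1) (q := s + 1) (hM (2 * s) le_rfl) (by omega)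
    rcases s with _ | s
    · have := tendsto_scaledMoment_succ (e := 0) (L₁ := 0) (L₂ := 0) (by omega) hM (by simp)
        (by simp) h₃
      convert this using 2
      simp [momentLimit]; norm_num
    · have h₁ := tendsto_pow_mul_div_pow (p := 2) (q := s + 1 + 1) (hM (2 * (s + 1) - 1) (by omega))
        (by omega)
      have h₂ := tendsto_pow_mul_div_pow (p := 2) (q := s + 1 + 1) (hM (2 * (s + 1) - 2) (by omega))
        (by omega)
      have := tendsto_scaledMoment_succ (by omega) hM (h₁.const_mul _) (h₂.const_mul _) h₃
      convert this using 2
      rw [show 2 * (s + 1) - 1 = 2 * s + 1 by omega, show 2 * (s + 1) - 2 = 2 * s by omega]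
      simp only [momentLimit_even, momentLimit_odd]
      rw [show 2 * (s + 1) - 1 = 2 * s + 1 by omega,
        show 2 * (s + 1) + 1 = (2 * s + 1) + 2 by omega, Nat.doubleFactorial_add_two,
        Nat.doubleFactorial_add_one]
      push_cast
      ring
  · rw [show (2 * s + 1 + 1) / 2 = s + 1 by omega]
    have h₁ := tendsto_pow_mul_div_pow (p := 2) (q := s + 1 + 1) (hM (2 * s + 1 - 1) (by omega))
      (by omega)
    have h₃ := tendsto_pow_mul_div_pow_zero (p := 1) (q := s + 1 + 1) (hM (2 * s + 1) le_rfl)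
      (by omega)
    have h₂ : Tendsto (fun n : ℕ => (8 * (2 * s + 1 : ℕ) * ((2 * s + 1 : ℕ) - 1) : ℝ) *
        ((n : ℝ) ^ 2 * scaledMoment (2 * s + 1 - 2) n / (n : ℝ) ^ (s + 1 + 1))) atTop (𝓝 0) := by
      rcases s with _ | s
      · simp
      · simpa using (tendsto_pow_mul_div_pow_zero (p := 2) (q := s + 1 + 1 + 1)
          (hM (2 * (s + 1) + 1 - 2) (by omega)) (by omega)).const_mul
          (8 * (2 * (s + 1) + 1 : ℕ) * ((2 * (s + 1) + 1 : ℕ) - 1) : ℝ)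
    have := tendsto_scaledMoment_succ (by omega) hM (h₁.const_mul _) h₂ h₃
    convert this using 2
    rw [show 2 * s + 1 + 1 = 2 * (s + 1) by omega, Nat.add_sub_cancel]
    simp only [momentLimit_even]
    rw [show 2 * (s + 1) - 1 = 2 * s + 1 by omega, Nat.doubleFactorial_add_one]
    push_cast
    ring

/-- Odd central moments of `S_{2,n}` (Lemma 3, odd case): for fixed `s ≥ 0`,
`⟨(S_{2,n} − n/4)^{2s+1}⟩ ∼ ((2s+1)!!/(2·4^{2s+1})) n^s`. -/
theorem odd_central_moments_S2 (s : ℕ) :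
    Tendsto (fun n : ℕ =>
        expect n (fun τ => ((BinTree.branches 2 τ : ℝ) - (n : ℝ) / 4) ^ (2*s+1))
          / ((Nat.doubleFactorial (2*s + 1) : ℝ) / (2 * 4 ^ (2*s+1)) * (n : ℝ) ^ s))
      atTop (𝓝 1) := by
  have h := tendsto_scaledMoment (2 * s + 1)
  rw [momentLimit_odd, show (2 * s + 1) / 2 = s by omega] at h
  have hpos : (Nat.doubleFactorial (2 * s + 1) : ℝ) ≠ 0 := by
    exact_mod_cast (Nat.doubleFactorial_pos _).ne'
  have h' := h.div_const ((Nat.doubleFactorial (2 * s + 1) : ℝ) / 2)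
  rw [div_self (by positivity)] at h'
  refine h'.congr fun n => ?_
  have hE : expect n (fun τ => ((BinTree.branches 2 τ : ℝ) - (n : ℝ) / 4) ^ (2 * s + 1)) =
      scaledMoment (2 * s + 1) n / 4 ^ (2 * s + 1) := by
    simp only [scaledMoment, expect]
    rw [div_right_comm]
    congr 1
    rw [Finset.sum_div]
    refine Finset.sum_congr rfl fun t _ => ?_
    rw [← div_pow]
    ring
  rw [hE]
  field_simp
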